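/- For q ∈ (0,1) and odd N, define M_q(N) = Σ_{k=(N+1)/2}^{N} (N choose k) q^k (1−q)^{N−k}, the probability that a Binomial(N,q) random variable is at least (N+1)/2. Then: (i) if q < 1/2, the sequence is strictly decreasing over odd N, i.e., M_q(N+2) < M_q(N) for every odd N ≥ 1; (ii) if q > 1/2, the sequence is strictly increasing over odd N, i.e., M_q(N+2) > M_q(N) for every odd N ≥ 1. -/

import Mathlib

/-- The probability that a binomial variable with parameters `n` and `q` equals `k`. -/
def binomialMass (q : ℝ) (n k : ℕ) : ℝ :=
  (n.choose k : ℝ) * q ^ k * (1 - q) ^ (n - k)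

/-- The probability that a binomial variable with parameters `n` and `q` is at least `j`. -/
def binomialTail (q : ℝ) (n j : ℕ) : ℝ :=
  ∑ k ∈ Finset.Icc j n, binomialMass q n k

theorem binomialMass_eq_zero_of_lt (q : ℝ) {n k : ℕ} (h : n < k) : binomialMass q n k = 0 := by
  simp [binomialMass, Nat.choose_eq_zero_of_lt h]

theorem binomialMass_succ_succ (q : ℝ) (n k : ℕ) :
    binomialMass q (n + 1) (k + 1) =
      q * binomialMass q n k + (1 - q) * binomialMass q n (k + 1) := by
  rcases Nat.lt_or_ge k n with h | h
  · obtain ⟨d, rfl⟩ := Nat.exists_eq_add_of_lt h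
    have h₁ : k + d + 1 + 1 - (k + 1) = d + 1 := by omega
    have h₂ : k + d + 1 - k = d + 1 := by omega
    have h₃ : k + d + 1 - (k + 1) = d := by omega
    simp only [binomialMass, Nat.choose_succ_succ' (k + d + 1) k, h₁, h₂, h₃]
    push_cast
    ring
  · rw [binomialMass_eq_zero_of_lt q (Nat.lt_succ_of_le h)]
    simp only [binomialMass, Nat.choose_succ_succ' n k,
      Nat.choose_eq_zero_of_lt (Nat.lt_succ_of_le h), Nat.add_sub_add_right]
    push_cast
    ring

theorem binomialTail_eq_add (q : ℝ) {n j : ℕ} (h : j ≤ n) :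
    binomialTail q n j = binomialMass q n j + binomialTail q n (j + 1) := by
  rw [binomialTail, binomialTail, ← Finset.insert_Icc_add_one_left_eq_Icc h,
    Finset.sum_insert (by simp)]

theorem binomialTail_succ_succ (q : ℝ) {n j : ℕ} (h : j ≤ n) :
    binomialTail q (n + 1) (j + 1) =
      q * binomialTail q n j + (1 - q) * binomialTail q n (j + 1) := by
  have shift (f : ℕ → ℝ) :
      ∑ k ∈ Finset.Icc (j + 1) (n + 1), f k = ∑ k ∈ Finset.Icc j n, f (k + 1) := by
    rw [← Finset.map_add_right_Icc, Finset.sum_map]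
    rfl
  have extend : binomialTail q n (j + 1) =
      ∑ k ∈ Finset.Icc j n, binomialMass q n (k + 1) := by
    rw [← shift, Finset.sum_Icc_succ_top (by omega),
      binomialMass_eq_zero_of_lt q (Nat.lt_succ_self n), add_zero, binomialTail]
  rw [extend, binomialTail, shift, binomialTail, Finset.mul_sum, Finset.mul_sum,
    ← Finset.sum_add_distrib]
  exact Finset.sum_congr rfl fun k _ => binomialMass_succ_succ q n k

/-- Two more voters change the majority-vote accuracy by a positive multiple of `2 * q - 1`. -/
theorem binomialTail_majority_add_two (q : ℝ) (m : ℕ) :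
    binomialTail q (2 * m + 3) (m + 2) = binomialTail q (2 * m + 1) (m + 1) +
      ((2 * m + 1).choose m : ℝ) * (q * (1 - q)) ^ (m + 1) * (2 * q - 1) := by
  have h₁ : 2 * m + 1 - m = m + 1 := by omega
  have h₂ : 2 * m + 1 - (m + 1) = m := by omega
  rw [binomialTail_succ_succ q (n := 2 * m + 2) (by omega),
    binomialTail_succ_succ q (n := 2 * m + 1) (by omega),
    binomialTail_succ_succ q (n := 2 * m + 1) (j := m + 1) (by omega),
    binomialTail_eq_add q (n := 2 * m + 1) (j := m) (by omega),
    binomialTail_eq_add q (n := 2 * m + 1) (j := m + 1) (by omega),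
    binomialMass, binomialMass, h₁, h₂, Nat.choose_symm_half, mul_pow]
  ring

/-- Monotonicity of the majority-vote accuracy
`M_q(N) = ∑_{k=(N+1)/2}^N (N choose k) q^k (1-q)^(N-k)` over odd `N`:
strictly decreasing (in steps of 2) when `q < 1/2`, strictly increasing when `q > 1/2`. -/
theorem majority_vote_monotone (q : ℝ) (hq0 : 0 < q) (hq1 : q < 1) :
    (q < 1 / 2 → ∀ N : ℕ, Odd N → 1 ≤ N →
      (∑ k ∈ Finset.Icc ((N + 2 + 1) / 2) (N + 2),
          ((N + 2).choose k : ℝ) * q ^ k * (1 - q) ^ (N + 2 - k)) <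
        ∑ k ∈ Finset.Icc ((N + 1) / 2) N,
          (N.choose k : ℝ) * q ^ k * (1 - q) ^ (N - k)) ∧
    (q > 1 / 2 → ∀ N : ℕ, Odd N → 1 ≤ N →
      (∑ k ∈ Finset.Icc ((N + 2 + 1) / 2) (N + 2),
          ((N + 2).choose k : ℝ) * q ^ k * (1 - q) ^ (N + 2 - k)) >
        ∑ k ∈ Finset.Icc ((N + 1) / 2) N,
          (N.choose k : ℝ) * q ^ k * (1 - q) ^ (N - k)) := by
  have gain_pos (m : ℕ) : 0 < ((2 * m + 1).choose m : ℝ) * (q * (1 - q)) ^ (m + 1) :=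
    mul_pos (mod_cast Nat.choose_pos (by omega)) (pow_pos (mul_pos hq0 (sub_pos.2 hq1)) _)
  constructor <;> rintro hq N ⟨m, rfl⟩ -
  all_goals
    have h₁ : (2 * m + 1 + 2 + 1) / 2 = m + 2 := by omega
    have h₂ : (2 * m + 1 + 1) / 2 = m + 1 := by omega
    rw [h₁, h₂]
  · change binomialTail q (2 * m + 3) (m + 2) < binomialTail q (2 * m + 1) (m + 1)
    rw [binomialTail_majority_add_two]
    linarith [mul_neg_of_pos_of_neg (gain_pos m) (by linarith : 2 * q - 1 < 0)]
  · change binomialTail q (2 * m + 1) (m + 1) < binomialTail q (2 * m + 3) (m + 2)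
    rw [binomialTail_majority_add_two]
    linarith [mul_pos (gain_pos m) (by linarith : 0 < 2 * q - 1)]
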